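/- arXiv:1506.06961 — 2 statements merged into one kernel-verified Lean document; each statement's English description precedes it below -/
import Mathlib

section
/- The sequence f, where f(n) = 0 if G(0,0,n) = 0 and f(n) = 1 otherwise, is not ultimately periodic: there do not exist natural numbers n₀ and p ≥ 1 such that f(n + p) = f(n) for all n ≥ n₀. -/
namespace SharingNim

/-- The moves of three-pile Sharing Nim: take `k ≥ 1` tokens from one pile and add them to
another pile, provided the receiving pile has at most as many tokens as the source pile
after the move (i.e. `2 * k` is at most the difference of the two piles). -/
def moves : ℕ × ℕ × ℕ → Finset (ℕ × ℕ × ℕ)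
  | (a, b, c) =>
    ((Finset.Icc 1 ((b - a) / 2)).image fun k => (a + k, b - k, c)) ∪
    ((Finset.Icc 1 ((a - b) / 2)).image fun k => (a - k, b + k, c)) ∪
    ((Finset.Icc 1 ((c - a) / 2)).image fun k => (a + k, b, c - k)) ∪
    ((Finset.Icc 1 ((a - c) / 2)).image fun k => (a - k, b, c + k)) ∪
    ((Finset.Icc 1 ((c - b) / 2)).image fun k => (a, b + k, c - k)) ∪
    ((Finset.Icc 1 ((b - c) / 2)).image fun k => (a, b - k, c + k))

/-- The sum of squares of the pile sizes, a measure that strictly decreases along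
every move. -/
def measure3 (p : ℕ × ℕ × ℕ) : ℕ := p.1 ^ 2 + p.2.1 ^ 2 + p.2.2 ^ 2

theorem sq_move_lt {x y k : ℕ} (hk : 1 ≤ k) (h : k ≤ (y - x) / 2) :
    (x + k) ^ 2 + (y - k) ^ 2 < x ^ 2 + y ^ 2 := by
  have h1 : x + 2 * k ≤ y := by omega
  have h2 : k ≤ y := by omega
  zify [h2]
  nlinarith

theorem measure3_lt_of_mem_moves {q p : ℕ × ℕ × ℕ} (h : q ∈ moves p) :
    measure3 q < measure3 p := by
  obtain ⟨a, b, c⟩ := p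
  simp only [moves, Finset.mem_union, Finset.mem_image, Finset.mem_Icc] at h
  rcases h with ((((⟨k, ⟨hk1, hk2⟩, rfl⟩ | ⟨k, ⟨hk1, hk2⟩, rfl⟩) | ⟨k, ⟨hk1, hk2⟩, rfl⟩) |
      ⟨k, ⟨hk1, hk2⟩, rfl⟩) | ⟨k, ⟨hk1, hk2⟩, rfl⟩) | ⟨k, ⟨hk1, hk2⟩, rfl⟩ <;>
    simp only [measure3] <;>
    [linarith [sq_move_lt (x := a) (y := b) hk1 hk2];
     linarith [sq_move_lt (x := b) (y := a) hk1 hk2];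
     linarith [sq_move_lt (x := a) (y := c) hk1 hk2];
     linarith [sq_move_lt (x := c) (y := a) hk1 hk2];
     linarith [sq_move_lt (x := b) (y := c) hk1 hk2];
     linarith [sq_move_lt (x := c) (y := b) hk1 hk2]]

/-- The minimum excludant of a finite set of naturals. -/
noncomputable def mex (s : Finset ℕ) : ℕ := sInf {n : ℕ | n ∉ s}

/-- The Sprague–Grundy value of a position of three-pile Sharing Nim: the minimum
excludant of the Sprague–Grundy values of the positions reachable in one move. -/
noncomputable def G (p : ℕ × ℕ × ℕ) : ℕ :=
  mex ((moves p).attach.image fun q => G q.1)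
termination_by measure3 p
decreasing_by exact measure3_lt_of_mem_moves q.2

open Classical in
/-- The indicator of N-positions of the form `(0,0,n)`: `f n = 0` iff `(0,0,n)` is a
P-position, and `f n = 1` otherwise. -/
noncomputable def f (n : ℕ) : ℕ := if G (0, 0, n) = 0 then 0 else 1

/-- Evenness of the 2-adic valuation. -/
def Ev (u : ℕ) : Prop := Even (padicValNat 2 u)

theorem ev_zero : Ev 0 := by simp [Ev]

theorem ev_odd {u : ℕ} (h : u % 2 = 1) : Ev u := by
  have : padicValNat 2 u = 0 := padicValNat.eq_zero_of_not_dvd (by omega)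
  simp [Ev, this]

theorem ev_two_mul {u : ℕ} (h : u ≠ 0) : Ev (2 * u) ↔ ¬ Ev u := by
  unfold Ev
  rw [padicValNat.mul (by norm_num) h, padicValNat.self (by norm_num), add_comm,
    Nat.even_add_one]

theorem ev_contra {d e : ℕ} (hd : Ev d) (he : Ev e) (h0 : e ≠ 0) (h : d = 2 * e) : False := by
  subst h
  exact (ev_two_mul h0).1 hd he

/-- Distance of naturals. -/
def ds (a b : ℕ) : ℕ := (a - b) + (b - a)

/-- The explicit description of the P-positions. -/
def PP (p : ℕ × ℕ × ℕ) : Prop :=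
  (p.1 = p.2.1 ∧ Ev (ds p.1 p.2.2)) ∨ (p.2.1 = p.2.2 ∧ Ev (ds p.1 p.2.1)) ∨
    (p.1 = p.2.2 ∧ Ev (ds p.1 p.2.1))

theorem mem_moves {a b c : ℕ} {q : ℕ × ℕ × ℕ} : q ∈ moves (a, b, c) ↔
    ∃ k, 1 ≤ k ∧ ((a + 2 * k ≤ b ∧ (a + k, b - k, c) = q) ∨ (b + 2 * k ≤ a ∧ (a - k, b + k, c) = q) ∨
      (a + 2 * k ≤ c ∧ (a + k, b, c - k) = q) ∨ (c + 2 * k ≤ a ∧ (a - k, b, c + k) = q) ∨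
      (b + 2 * k ≤ c ∧ (a, b + k, c - k) = q) ∨ (c + 2 * k ≤ b ∧ (a, b - k, c + k) = q)) := by
  simp only [moves, Finset.mem_union, Finset.mem_image, Finset.mem_Icc]
  constructor
  · rintro (((((⟨k, h, e⟩ | ⟨k, h, e⟩) | ⟨k, h, e⟩) | ⟨k, h, e⟩) | ⟨k, h, e⟩) | ⟨k, h, e⟩) <;>
      refine ⟨k, h.1, ?_⟩
    · exact Or.inl ⟨by omega, e⟩
    · exact Or.inr (Or.inl ⟨by omega, e⟩)
    · exact Or.inr (Or.inr (Or.inl ⟨by omega, e⟩))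
    · exact Or.inr (Or.inr (Or.inr (Or.inl ⟨by omega, e⟩)))
    · exact Or.inr (Or.inr (Or.inr (Or.inr (Or.inl ⟨by omega, e⟩))))
    · exact Or.inr (Or.inr (Or.inr (Or.inr (Or.inr ⟨by omega, e⟩))))
  · rintro ⟨k, h1, (⟨h, e⟩ | ⟨h, e⟩ | ⟨h, e⟩ | ⟨h, e⟩ | ⟨h, e⟩ | ⟨h, e⟩)⟩
    · exact Or.inl (Or.inl (Or.inl (Or.inl (Or.inl ⟨k, by omega, e⟩))))
    · exact Or.inl (Or.inl (Or.inl (Or.inl (Or.inr ⟨k, by omega, e⟩))))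
    · exact Or.inl (Or.inl (Or.inl (Or.inr ⟨k, by omega, e⟩)))
    · exact Or.inl (Or.inl (Or.inr ⟨k, by omega, e⟩))
    · exact Or.inl (Or.inr ⟨k, by omega, e⟩)
    · exact Or.inr ⟨k, by omega, e⟩

theorem not_PP_of_move {p q : ℕ × ℕ × ℕ} (hp : PP p) (hq : q ∈ moves p) : ¬ PP q := by
  obtain ⟨a, b, c⟩ := p
  rw [mem_moves] at hq
  intro h
  obtain ⟨k, hk, hq⟩ := hq
  rcases hq with ⟨hk2, rfl⟩ | ⟨hk2, rfl⟩ | ⟨hk2, rfl⟩ | ⟨hk2, rfl⟩ | ⟨hk2, rfl⟩ | ⟨hk2, rfl⟩ <;>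
  simp only [PP] at hp h <;>
  rcases hp with ⟨e1, h1⟩ | ⟨e1, h1⟩ | ⟨e1, h1⟩ <;>
  rcases h with ⟨e2, h2⟩ | ⟨e2, h2⟩ | ⟨e2, h2⟩ <;>
  first
  | omega
  | exact ev_contra h1 h2 (by unfold ds; omega) (by unfold ds; omega)

/-- There is a move to a claimed P-position. -/
def W (p : ℕ × ℕ × ℕ) : Prop := PP p ∨ ∃ q ∈ moves p, PP q

theorem PP_swap1 {a b c : ℕ} (h : PP (a, b, c)) : PP (b, a, c) := by
  simp only [PP] at *
  rcases h with ⟨rfl, h⟩ | ⟨rfl, h⟩ | ⟨rfl, h⟩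
  · exact Or.inl ⟨rfl, h⟩
  · exact Or.inr (Or.inr ⟨rfl, by rwa [ds, add_comm]⟩)
  · exact Or.inr (Or.inl ⟨rfl, by rwa [ds, add_comm]⟩)

theorem PP_swap2 {a b c : ℕ} (h : PP (a, b, c)) : PP (a, c, b) := by
  simp only [PP] at *
  rcases h with ⟨rfl, h⟩ | ⟨rfl, h⟩ | ⟨rfl, h⟩
  · exact Or.inr (Or.inr ⟨rfl, h⟩)
  · exact Or.inr (Or.inl ⟨rfl, h⟩)
  · exact Or.inl ⟨rfl, h⟩

theorem W_swap1 {a b c : ℕ} (h : W (a, b, c)) : W (b, a, c) := by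
  rcases h with h | ⟨⟨x, y, z⟩, hq, h⟩
  · exact Or.inl (PP_swap1 h)
  · refine Or.inr ⟨(y, x, z), ?_, PP_swap1 h⟩
    rw [mem_moves] at *
    obtain ⟨k, hk, hq⟩ := hq
    refine ⟨k, hk, ?_⟩
    simp only [Prod.mk.injEq] at *
    rcases hq with ⟨h, e1, e2, e3⟩ | ⟨h, e1, e2, e3⟩ | ⟨h, e1, e2, e3⟩ | ⟨h, e1, e2, e3⟩ | ⟨h, e1, e2, e3⟩ | ⟨h, e1, e2, e3⟩
    · exact Or.inr (Or.inl ⟨h, e2, e1, e3⟩)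
    · exact Or.inl ⟨h, e2, e1, e3⟩
    · exact Or.inr (Or.inr (Or.inr (Or.inr (Or.inl ⟨h, e2, e1, e3⟩))))
    · exact Or.inr (Or.inr (Or.inr (Or.inr (Or.inr (⟨h, e2, e1, e3⟩)))))
    · exact Or.inr (Or.inr (Or.inl ⟨h, e2, e1, e3⟩))
    · exact Or.inr (Or.inr (Or.inr (Or.inl ⟨h, e2, e1, e3⟩)))

theorem W_swap2 {a b c : ℕ} (h : W (a, b, c)) : W (a, c, b) := by
  rcases h with h | ⟨⟨x, y, z⟩, hq, h⟩
  · exact Or.inl (PP_swap2 h)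
  · refine Or.inr ⟨(x, z, y), ?_, PP_swap2 h⟩
    rw [mem_moves] at *
    obtain ⟨k, hk, hq⟩ := hq
    refine ⟨k, hk, ?_⟩
    simp only [Prod.mk.injEq] at *
    rcases hq with ⟨h, e1, e2, e3⟩ | ⟨h, e1, e2, e3⟩ | ⟨h, e1, e2, e3⟩ | ⟨h, e1, e2, e3⟩ | ⟨h, e1, e2, e3⟩ | ⟨h, e1, e2, e3⟩
    · exact Or.inr (Or.inr (Or.inl ⟨h, e1, e3, e2⟩))
    · exact Or.inr (Or.inr (Or.inr (Or.inl ⟨h, e1, e3, e2⟩)))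
    · exact Or.inl ⟨h, e1, e3, e2⟩
    · exact Or.inr (Or.inl ⟨h, e1, e3, e2⟩)
    · exact Or.inr (Or.inr (Or.inr (Or.inr (Or.inr (⟨h, e1, e3, e2⟩)))))
    · exact Or.inr (Or.inr (Or.inr (Or.inr (Or.inl ⟨h, e1, e3, e2⟩))))

theorem W_sorted {a b c : ℕ} (hab : a ≤ b) (hbc : b ≤ c) : W (a, b, c) := by
  by_cases hP : PP (a, b, c)
  · exact Or.inl hP
  refine Or.inr ?_
  -- the general move: keep `b`, make the two others sum to `a + c`
  have move : ∀ k, 1 ≤ k → a + 2 * k ≤ c → PP (a + k, b, c - k) →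
      ∃ q ∈ moves (a, b, c), PP q := fun k h1 h2 h3 =>
    ⟨_, mem_moves.2 ⟨k, h1, Or.inr (Or.inr (Or.inl ⟨h2, rfl⟩))⟩, h3⟩
  have hac : a < c := by
    by_contra hcon
    obtain rfl : a = b := by omega
    obtain rfl : a = c := by omega
    exact hP (Or.inl ⟨rfl, by simpa [ds] using ev_zero⟩)
  by_cases hpar : (a + c) % 2 = 1
  · -- odd difference
    have hne : a ≠ b := by
      rintro rfl
      exact hP (Or.inl ⟨rfl, ev_odd (by simp only [ds]; omega)⟩)
    have hne2 : b ≠ c := by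
      rintro rfl
      exact hP (Or.inr (Or.inl ⟨rfl, ev_odd (by simp only [ds]; omega)⟩))
    rcases le_total (b - a) (c - b) with hle | hle
    · exact move (b - a) (by omega) (by omega)
        (Or.inl ⟨by simp only; omega, ev_odd (by simp only [ds]; omega)⟩)
    · exact move (c - b) (by omega) (by omega)
        (Or.inr (Or.inl ⟨by simp only; omega, ev_odd (by simp only [ds]; omega)⟩))
  · by_cases hmid : Ev (ds (a + (c - a) / 2) b)
    · exact move ((c - a) / 2) (by omega) (by omega)
        (Or.inr (Or.inr ⟨by simp only; omega, hmid⟩))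
    · have h0 : ds (a + (c - a) / 2) b ≠ 0 := fun h => hmid (by rw [h]; exact ev_zero)
      have h2 := (ev_two_mul h0).2 hmid
      have hne : a ≠ b := by
        rintro rfl
        refine hP (Or.inl ⟨rfl, ?_⟩)
        convert h2 using 1
        simp only [ds]; omega
      have hne2 : b ≠ c := by
        rintro rfl
        refine hP (Or.inr (Or.inl ⟨rfl, ?_⟩))
        convert h2 using 1
        simp only [ds]; omega
      rcases le_total (b - a) (c - b) with hle | hle
      · refine move (b - a) (by omega) (by omega) (Or.inl ⟨by simp only; omega, ?_⟩)
        convert h2 using 1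
        simp only [ds]; omega
      · refine move (c - b) (by omega) (by omega) (Or.inr (Or.inl ⟨by simp only; omega, ?_⟩))
        convert h2 using 1
        simp only [ds]; omega

theorem W_all (p : ℕ × ℕ × ℕ) : W p := by
  obtain ⟨a, b, c⟩ := p
  rcases le_total a b with h1 | h1 <;> rcases le_total b c with h2 | h2 <;>
    rcases le_total a c with h3 | h3
  · exact W_sorted h1 h2
  · exact W_sorted h1 h2
  · exact W_swap2 (W_sorted h3 h2)
  · exact W_swap2 (W_swap1 (W_sorted h3 h1))
  · exact W_swap1 (W_sorted h1 h3)
  · exact W_swap1 (W_swap2 (W_sorted h2 h3))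
  · exact W_swap1 (W_swap2 (W_swap1 (W_sorted h2 h1)))
  · exact W_swap1 (W_swap2 (W_swap1 (W_sorted h2 h1)))

theorem mex_eq_zero (s : Finset ℕ) : mex s = 0 ↔ 0 ∉ s := by
  unfold mex
  rw [Nat.sInf_eq_zero]
  constructor
  · rintro (h | h)
    · exact h
    · exfalso
      obtain ⟨n, hn⟩ := Infinite.exists_notMem_finset s
      have : n ∈ {n : ℕ | n ∉ s} := hn
      rw [h] at this
      exact this
  · exact fun h => Or.inl h

theorem G_eq_zero (p : ℕ × ℕ × ℕ) : G p = 0 ↔ ∀ q ∈ moves p, G q ≠ 0 := by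
  rw [G, mex_eq_zero]
  simp

theorem G_iff_PP (p : ℕ × ℕ × ℕ) : G p = 0 ↔ PP p := by
  induction hn : measure3 p using Nat.strong_induction_on generalizing p with
  | _ n ih =>
    subst hn
    have ih' : ∀ q ∈ moves p, (G q = 0 ↔ PP q) := fun q hq =>
      ih _ (measure3_lt_of_mem_moves hq) q rfl
    rw [G_eq_zero]
    constructor
    · intro h
      rcases W_all p with hp | ⟨q, hq, hP⟩
      · exact hp
      · exact absurd ((ih' q hq).2 hP) (h q hq)
    · exact fun hp q hq h0 => not_PP_of_move hp hq ((ih' q hq).1 h0)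

theorem f_eq_zero (n : ℕ) : f n = 0 ↔ Ev n := by
  have h : f n = 0 ↔ G (0, 0, n) = 0 := by
    unfold f
    split_ifs with h <;> simp [h]
  rw [h, G_iff_PP]
  constructor
  · rintro (⟨_, h⟩ | ⟨h, _⟩ | ⟨h, _⟩)
    · simpa [ds] using h
    · simp only at h; subst h; exact ev_zero
    · simp only at h; subst h; exact ev_zero
  · exact fun h => Or.inl ⟨rfl, by simpa [ds] using h⟩

theorem ev_odd_mul {m u : ℕ} (hm : m % 2 = 1) (hu : u ≠ 0) : Ev (m * u) ↔ Ev u := by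
  unfold Ev
  rw [padicValNat.mul (by omega) hu, padicValNat.eq_zero_of_not_dvd (by omega : ¬ 2 ∣ m), zero_add]

/-- The sequence `f` is not ultimately periodic. -/
theorem f_not_ultimately_periodic :
    ¬ ∃ n₀ p : ℕ, 1 ≤ p ∧ ∀ n : ℕ, n₀ ≤ n → f (n + p) = f n := by
  rintro ⟨n₀, p, hp, h⟩
  have h1 := h ((4 * n₀ + 1) * p) (by nlinarith)
  have e : (4 * n₀ + 1) * p + p = 2 * ((2 * n₀ + 1) * p) := by ring
  have hp0 : p ≠ 0 := by omega
  have h2 : Ev (2 * ((2 * n₀ + 1) * p)) ↔ Ev ((4 * n₀ + 1) * p) := by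
    rw [← f_eq_zero, ← f_eq_zero, ← e, h1]
  rw [ev_two_mul (by positivity), ev_odd_mul (by omega) hp0, ev_odd_mul (by omega) hp0] at h2
  tauto

end SharingNim
end

section
/- For all natural numbers a, b with a ≤ b, G(0, a, b) = 1 if and only if the pair (a, b) belongs to the set {(0, 4k+2) : k ≥ 0} ∪ {(4k+2, 4k+2) : k ≥ 0} ∪ {(1, 2)} ∪ {(2, 4k+1) : k ≥ 1} ∪ {(4l−1, 4l+1) : l ≥ 1}; that is, the positions of Sprague–Grundy value 1 are exactly those equivalent to (0,0,4k+2), (0,4k+2,4k+2), (0,2,4k+1) (k ≥ 0, with (0,2,1) reordered as (0,1,2)), and (0,4l−1,4l+1) (l ≥ 1). -/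
namespace SharingNim

/-- `E n` holds iff `n = 0` or the 2-adic valuation of `n` is even. -/
def E (n : ℕ) : Prop := n = 0 ∨ Even (padicValNat 2 n)

theorem E_zero : E 0 := Or.inl rfl

theorem E_double (m : ℕ) (hm : 0 < m) : E (2 * m) ↔ ¬ E m := by
  have h : padicValNat 2 (2 * m) = 1 + padicValNat 2 m := by
    rw [padicValNat.mul (by norm_num) (by omega)]
    simp
  unfold E
  rw [h, add_comm, Nat.even_add_one]
  constructor
  · rintro (h | h)
    · omega
    · rintro (h' | h')
      · omega
      · exact h h'
  · intro h'
    right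
    intro h2
    exact h' (Or.inr h2)

theorem E_odd (m : ℕ) (hm : m % 2 = 1) : E m := by
  right
  rw [padicValNat.eq_zero_of_not_dvd (by omega)]
  exact Even.zero

theorem not_E_two (m : ℕ) (hm : m % 4 = 2) : ¬ E m := by
  obtain ⟨k, rfl⟩ : ∃ k, m = 2 * k := ⟨m / 2, by omega⟩
  rw [E_double k (by omega), not_not]
  exact E_odd k (by omega)

theorem not_E_cases (m : ℕ) (h : ¬ E m) : (m % 4 = 2) ∨ (m % 8 = 0 ∧ 0 < m) := by
  have h0 : m ≠ 0 := fun h' => h (h' ▸ E_zero)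
  have h1 : m % 2 ≠ 1 := fun h' => h (E_odd m h')
  have h2 : m % 8 ≠ 4 := by
    intro h'
    apply h
    obtain ⟨k, rfl⟩ : ∃ k, m = 2 * k := ⟨m / 2, by omega⟩
    rw [E_double k (by omega)]
    exact not_E_two k (by omega)
  omega

/-- Candidate positions of value 0. -/
def P (x y z : ℕ) : Prop :=
  ∃ n, E n ∧ ((x = y ∧ (z = x + n ∨ x = z + n)) ∨ (x = z ∧ (y = x + n ∨ x = y + n)) ∨
    (y = z ∧ (x = y + n ∨ y = x + n)))

/-- Candidate positions of value 1. -/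
def Q (x y z : ℕ) : Prop :=
  (x = y ∧ z % 4 = (x + 2) % 4) ∨ (x = z ∧ y % 4 = (x + 2) % 4) ∨
  (y = z ∧ x % 4 = (y + 2) % 4) ∨
  (y = x + 2 ∧ z % 4 = (x + 1) % 4) ∨ (x = y + 2 ∧ z % 4 = (y + 1) % 4) ∨
  (z = x + 2 ∧ y % 4 = (x + 1) % 4) ∨ (x = z + 2 ∧ y % 4 = (z + 1) % 4) ∨
  (z = y + 2 ∧ x % 4 = (y + 1) % 4) ∨ (y = z + 2 ∧ x % 4 = (z + 1) % 4)

theorem P_12 (x y z : ℕ) (h : P x y z) : P y x z := by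
  obtain ⟨n, hn, h⟩ := h
  exact ⟨n, hn, by omega⟩

theorem P_23 (x y z : ℕ) (h : P x y z) : P x z y := by
  obtain ⟨n, hn, h⟩ := h
  exact ⟨n, hn, by omega⟩

theorem Q_mk1 {x y z : ℕ} (h : x = y) (h' : z % 4 = (x + 2) % 4) : Q x y z :=
  Or.inl ⟨h, h'⟩

theorem Q_mk2 {x y z : ℕ} (h : x = z) (h' : y % 4 = (x + 2) % 4) : Q x y z :=
  Or.inr (Or.inl ⟨h, h'⟩)

theorem Q_mk3 {x y z : ℕ} (h : y = z) (h' : x % 4 = (y + 2) % 4) : Q x y z :=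
  Or.inr (Or.inr (Or.inl ⟨h, h'⟩))

theorem Q_mk4 {x y z : ℕ} (h : y = x + 2) (h' : z % 4 = (x + 1) % 4) : Q x y z :=
  Or.inr (Or.inr (Or.inr (Or.inl ⟨h, h'⟩)))

theorem Q_mk5 {x y z : ℕ} (h : x = y + 2) (h' : z % 4 = (y + 1) % 4) : Q x y z :=
  Or.inr (Or.inr (Or.inr (Or.inr (Or.inl ⟨h, h'⟩))))

theorem Q_mk6 {x y z : ℕ} (h : z = x + 2) (h' : y % 4 = (x + 1) % 4) : Q x y z :=
  Or.inr (Or.inr (Or.inr (Or.inr (Or.inr (Or.inl ⟨h, h'⟩)))))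

theorem Q_mk7 {x y z : ℕ} (h : x = z + 2) (h' : y % 4 = (z + 1) % 4) : Q x y z :=
  Or.inr (Or.inr (Or.inr (Or.inr (Or.inr (Or.inr (Or.inl ⟨h, h'⟩))))))

theorem Q_mk8 {x y z : ℕ} (h : z = y + 2) (h' : x % 4 = (y + 1) % 4) : Q x y z :=
  Or.inr (Or.inr (Or.inr (Or.inr (Or.inr (Or.inr (Or.inr (Or.inl ⟨h, h'⟩)))))))

theorem Q_mk9 {x y z : ℕ} (h : y = z + 2) (h' : x % 4 = (z + 1) % 4) : Q x y z :=
  Or.inr (Or.inr (Or.inr (Or.inr (Or.inr (Or.inr (Or.inr (Or.inr ⟨h, h'⟩)))))))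

theorem Q_12 (x y z : ℕ) (h : Q x y z) : Q y x z := by
  rcases h with ⟨h, h'⟩ | ⟨h, h'⟩ | ⟨h, h'⟩ | ⟨h, h'⟩ | ⟨h, h'⟩ | ⟨h, h'⟩ | ⟨h, h'⟩ | ⟨h, h'⟩ | ⟨h, h'⟩
  · exact Q_mk1 (by omega) (by omega)
  · exact Q_mk3 (by omega) (by omega)
  · exact Q_mk2 (by omega) (by omega)
  · exact Q_mk5 (by omega) (by omega)
  · exact Q_mk4 (by omega) (by omega)
  · exact Q_mk8 (by omega) (by omega)
  · exact Q_mk9 (by omega) (by omega)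
  · exact Q_mk6 (by omega) (by omega)
  · exact Q_mk7 (by omega) (by omega)

theorem Q_23 (x y z : ℕ) (h : Q x y z) : Q x z y := by
  rcases h with ⟨h, h'⟩ | ⟨h, h'⟩ | ⟨h, h'⟩ | ⟨h, h'⟩ | ⟨h, h'⟩ | ⟨h, h'⟩ | ⟨h, h'⟩ | ⟨h, h'⟩ | ⟨h, h'⟩
  · exact Q_mk2 (by omega) (by omega)
  · exact Q_mk1 (by omega) (by omega)
  · exact Q_mk3 (by omega) (by omega)
  · exact Q_mk6 (by omega) (by omega)
  · exact Q_mk7 (by omega) (by omega)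
  · exact Q_mk4 (by omega) (by omega)
  · exact Q_mk5 (by omega) (by omega)
  · exact Q_mk9 (by omega) (by omega)
  · exact Q_mk8 (by omega) (by omega)

/-- Some move leads into the set `T`. -/
def R (T : ℕ → ℕ → ℕ → Prop) (x y z : ℕ) : Prop :=
  ∃ k, 1 ≤ k ∧
    ((x + 2 * k ≤ y ∧ T (x + k) (y - k) z) ∨ (y + 2 * k ≤ x ∧ T (x - k) (y + k) z) ∨
     (x + 2 * k ≤ z ∧ T (x + k) y (z - k)) ∨ (z + 2 * k ≤ x ∧ T (x - k) y (z + k)) ∨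
     (y + 2 * k ≤ z ∧ T x (y + k) (z - k)) ∨ (z + 2 * k ≤ y ∧ T x (y - k) (z + k)))

theorem exists_move_iff (T : ℕ → ℕ → ℕ → Prop) (x y z : ℕ) :
    (∃ q ∈ moves (x, y, z), T q.1 q.2.1 q.2.2) ↔ R T x y z := by
  constructor
  · rintro ⟨q, hq, hT⟩
    simp only [moves, Finset.mem_union, Finset.mem_image, Finset.mem_Icc] at hq
    rcases hq with ((((⟨k, ⟨hk1, hk2⟩, rfl⟩ | ⟨k, ⟨hk1, hk2⟩, rfl⟩) | ⟨k, ⟨hk1, hk2⟩, rfl⟩) |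
      ⟨k, ⟨hk1, hk2⟩, rfl⟩) | ⟨k, ⟨hk1, hk2⟩, rfl⟩) | ⟨k, ⟨hk1, hk2⟩, rfl⟩ <;>
    refine ⟨k, hk1, ?_⟩
    · exact Or.inl ⟨by omega, hT⟩
    · exact Or.inr (Or.inl ⟨by omega, hT⟩)
    · exact Or.inr (Or.inr (Or.inl ⟨by omega, hT⟩))
    · exact Or.inr (Or.inr (Or.inr (Or.inl ⟨by omega, hT⟩)))
    · exact Or.inr (Or.inr (Or.inr (Or.inr (Or.inl ⟨by omega, hT⟩))))
    · exact Or.inr (Or.inr (Or.inr (Or.inr (Or.inr ⟨by omega, hT⟩))))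
  · rintro ⟨k, hk, h⟩
    simp only [moves, Finset.mem_union, Finset.mem_image, Finset.mem_Icc]
    rcases h with ⟨h, hT⟩ | ⟨h, hT⟩ | ⟨h, hT⟩ | ⟨h, hT⟩ | ⟨h, hT⟩ | ⟨h, hT⟩
    · exact ⟨_, Or.inl (Or.inl (Or.inl (Or.inl (Or.inl ⟨k, ⟨hk, by omega⟩, rfl⟩)))), hT⟩
    · exact ⟨_, Or.inl (Or.inl (Or.inl (Or.inl (Or.inr ⟨k, ⟨hk, by omega⟩, rfl⟩)))), hT⟩
    · exact ⟨_, Or.inl (Or.inl (Or.inl (Or.inr ⟨k, ⟨hk, by omega⟩, rfl⟩))), hT⟩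
    · exact ⟨_, Or.inl (Or.inl (Or.inr ⟨k, ⟨hk, by omega⟩, rfl⟩)), hT⟩
    · exact ⟨_, Or.inl (Or.inr ⟨k, ⟨hk, by omega⟩, rfl⟩), hT⟩
    · exact ⟨_, Or.inr ⟨k, ⟨hk, by omega⟩, rfl⟩, hT⟩

theorem R_12 (T : ℕ → ℕ → ℕ → Prop) (h12 : ∀ x y z, T x y z → T y x z)
    (x y z : ℕ) (h : R T x y z) : R T y x z := by
  obtain ⟨k, hk, h⟩ := h
  refine ⟨k, hk, ?_⟩
  rcases h with ⟨h, hT⟩ | ⟨h, hT⟩ | ⟨h, hT⟩ | ⟨h, hT⟩ | ⟨h, hT⟩ | ⟨h, hT⟩ <;>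
    have := h12 _ _ _ hT <;> tauto

theorem R_23 (T : ℕ → ℕ → ℕ → Prop) (h23 : ∀ x y z, T x y z → T x z y)
    (x y z : ℕ) (h : R T x y z) : R T x z y := by
  obtain ⟨k, hk, h⟩ := h
  refine ⟨k, hk, ?_⟩
  rcases h with ⟨h, hT⟩ | ⟨h, hT⟩ | ⟨h, hT⟩ | ⟨h, hT⟩ | ⟨h, hT⟩ | ⟨h, hT⟩ <;>
    have := h23 _ _ _ hT <;> tauto

/-- Reduction of a symmetric claim to sorted triples. -/
theorem sorted_reduction (S : ℕ → ℕ → ℕ → Prop) (h12 : ∀ x y z, S x y z → S y x z)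
    (h23 : ∀ x y z, S x y z → S x z y)
    (hs : ∀ a b c, a ≤ b → b ≤ c → S a b c) (x y z : ℕ) : S x y z := by
  rcases le_total x y with h1 | h1 <;> rcases le_total y z with h2 | h2 <;>
    rcases le_total x z with h3 | h3
  · exact hs _ _ _ h1 h2
  · exact hs _ _ _ h1 h2
  · exact h23 _ _ _ (hs _ _ _ h3 h2)
  · exact h23 _ _ _ (h12 _ _ _ (hs _ _ _ h3 h1))
  · exact h12 _ _ _ (hs _ _ _ h1 h3)
  · exact h12 _ _ _ (h23 _ _ _ (hs _ _ _ h2 h3))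
  · exact h12 _ _ _ (h23 _ _ _ (h12 _ _ _ (hs _ _ _ h2 h1)))
  · exact h12 _ _ _ (h23 _ _ _ (h12 _ _ _ (hs _ _ _ h2 h1)))

theorem no_move (T : ℕ → ℕ → ℕ → Prop) (h12 : ∀ x y z, T x y z → T y x z)
    (h23 : ∀ x y z, T x y z → T x z y)
    (hT : ∀ x y z k, T x y z → 1 ≤ k → x + 2 * k ≤ y → T (x + k) (y - k) z → False)
    (x y z : ℕ) (h : T x y z) : ¬ R T x y z := by
  rintro ⟨k, hk, ⟨h1, h2⟩ | ⟨h1, h2⟩ | ⟨h1, h2⟩ | ⟨h1, h2⟩ | ⟨h1, h2⟩ | ⟨h1, h2⟩⟩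
  · exact hT _ _ _ k h hk h1 h2
  · exact hT _ _ _ k (h12 _ _ _ h) hk h1 (h12 _ _ _ h2)
  · exact hT _ _ _ k (h23 _ _ _ h) hk h1 (h23 _ _ _ h2)
  · exact hT _ _ _ k (h12 _ _ _ (h23 _ _ _ h)) hk h1 (h12 _ _ _ (h23 _ _ _ h2))
  · exact hT _ _ _ k (h23 _ _ _ (h12 _ _ _ h)) hk h1 (h23 _ _ _ (h12 _ _ _ h2))
  · exact hT _ _ _ k (h12 _ _ _ (h23 _ _ _ (h12 _ _ _ h))) hk h1
      (h12 _ _ _ (h23 _ _ _ (h12 _ _ _ h2)))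

theorem no_PP (x y z : ℕ) (h : P x y z) : ¬ R P x y z := by
  refine no_move P P_12 P_23 ?_ x y z h
  rintro x y z k ⟨n, hn, h⟩ hk hxy ⟨m, hm, h'⟩
  have hnm : n = 2 * m ∧ 0 < m := by omega
  obtain ⟨rfl, hm0⟩ := hnm
  exact (E_double m hm0).1 hn hm

theorem no_QQ (x y z : ℕ) (h : Q x y z) : ¬ R Q x y z := by
  refine no_move Q Q_12 Q_23 ?_ x y z h
  intro x y z k h hk hxy h'
  unfold Q at h h'
  rcases h with h | h | h | h | h | h | h | h | h <;> omega

theorem not_P_of_Q (x y z : ℕ) (h : Q x y z) : ¬ P x y z := by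
  rintro ⟨n, hn, h'⟩
  unfold Q at h
  exact not_E_two n (by omega) hn

theorem exists_P_sorted (a b c : ℕ) (hab : a ≤ b) (hbc : b ≤ c) : P a b c ∨ R P a b c := by
  rcases Nat.eq_or_lt_of_le hab with rfl | hab
  · by_cases hE : E (c - a)
    · exact Or.inl ⟨_, hE, by omega⟩
    · have h := not_E_cases _ hE
      obtain ⟨m, hm⟩ : ∃ m, c - a = 2 * m := ⟨(c - a) / 2, by omega⟩
      rw [hm, E_double m (by omega), not_not] at hE
      exact Or.inr ⟨m, by omega, Or.inr (Or.inr (Or.inl ⟨by omega, m, hE, by omega⟩))⟩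
  rcases Nat.eq_or_lt_of_le hbc with rfl | hbc
  · by_cases hE : E (b - a)
    · exact Or.inl ⟨_, hE, by omega⟩
    · have h := not_E_cases _ hE
      obtain ⟨m, hm⟩ : ∃ m, b - a = 2 * m := ⟨(b - a) / 2, by omega⟩
      rw [hm, E_double m (by omega), not_not] at hE
      exact Or.inr ⟨m, by omega, Or.inl ⟨by omega, m, hE, by omega⟩⟩
  right
  obtain ⟨u, rfl⟩ : ∃ u, b = a + u := ⟨b - a, by omega⟩
  obtain ⟨v, rfl⟩ : ∃ v, c = a + v := ⟨c - a, by omega⟩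
  by_cases hE : E ((v - 2 * u) + (2 * u - v))
  · rcases le_total (2 * u) v with h | h
    · exact ⟨u, by omega, Or.inr (Or.inr (Or.inl ⟨by omega, _, hE, by omega⟩))⟩
    · exact ⟨v - u, by omega, Or.inr (Or.inr (Or.inl ⟨by omega, _, hE, by omega⟩))⟩
  · have h := not_E_cases _ hE
    obtain ⟨m, hm⟩ : ∃ m, (v - 2 * u) + (2 * u - v) = 2 * m :=
      ⟨((v - 2 * u) + (2 * u - v)) / 2, by omega⟩
    rw [hm, E_double m (by omega), not_not] at hE
    exact ⟨v / 2, by omega, Or.inr (Or.inr (Or.inl ⟨by omega, m, hE, by omega⟩))⟩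

theorem exists_Q_sorted (a b c : ℕ) (hab : a ≤ b) (hbc : b ≤ c) :
    P a b c ∨ Q a b c ∨ R Q a b c := by
  by_cases hP : P a b c
  · exact Or.inl hP
  by_cases hQ : Q a b c
  · exact Or.inr (Or.inl hQ)
  right; right
  have move02 : ∀ k, 1 ≤ k → a + 2 * k ≤ c → Q (a + k) b (c - k) → R Q a b c :=
    fun k hk h h' => ⟨k, hk, Or.inr (Or.inr (Or.inl ⟨h, h'⟩))⟩
  have move01 : ∀ k, 1 ≤ k → a + 2 * k ≤ b → Q (a + k) (b - k) c → R Q a b c :=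
    fun k hk h h' => ⟨k, hk, Or.inl ⟨h, h'⟩⟩
  have move12 : ∀ k, 1 ≤ k → b + 2 * k ≤ c → Q a (b + k) (c - k) → R Q a b c :=
    fun k hk h h' => ⟨k, hk, Or.inr (Or.inr (Or.inr (Or.inr (Or.inl ⟨h, h'⟩))))⟩
  rcases Nat.eq_or_lt_of_le hab with rfl | hab
  · have hE : ¬ E (c - a) := fun hE => hP ⟨_, hE, by omega⟩
    have h := not_E_cases _ hE
    have h4 : ¬ (c - a) % 4 = 2 := fun h' => hQ (Q_mk1 (by omega) (by omega))
    exact move02 ((c - a) / 2 - 1) (by omega) (by omega) (Q_mk6 (by omega) (by omega))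
  rcases Nat.eq_or_lt_of_le hbc with rfl | hbc
  · have hE : ¬ E (b - a) := fun hE => hP ⟨_, hE, by omega⟩
    have h := not_E_cases _ hE
    have h4 : ¬ (b - a) % 4 = 2 := fun h' => hQ (Q_mk3 (by omega) (by omega))
    exact move01 ((b - a) / 2 - 1) (by omega) (by omega) (Q_mk4 (by omega) (by omega))
  clear hP
  obtain ⟨u, rfl⟩ : ∃ u, b = a + u := ⟨b - a, by omega⟩
  obtain ⟨v, rfl⟩ : ∃ v, c = a + v := ⟨c - a, by omega⟩
  by_cases hv : v % 2 = 0
  · obtain ⟨w, rfl⟩ : ∃ w, v = 2 * w := ⟨v / 2, by omega⟩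
    by_cases h1 : (w + u) % 2 = 1
    · rcases le_total u w with h | h
      · exact move02 u (by omega) (by omega) (Q_mk1 (by omega) (by omega))
      · exact move02 (2 * w - u) (by omega) (by omega) (Q_mk3 (by omega) (by omega))
    by_cases h2 : (w + 3 * u) % 4 = 2
    · exact move02 w (by omega) (by omega) (Q_mk2 (by omega) (by omega))
    have hw : 2 ≤ w := by
      by_contra hw
      exact hQ (Q_mk6 (by omega) (by omega))
    exact move02 (w - 1) (by omega) (by omega) (Q_mk6 (by omega) (by omega))
  · by_cases h1 : v % 4 = (2 * u + 3) % 4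
    · by_cases h2 : v = u + 1
      · by_cases h3 : u % 8 = 2
        · exact move01 (u / 2) (by omega) (by omega) (Q_mk1 (by omega) (by omega))
        · exact move01 (u / 2 - 1) (by omega) (by omega) (Q_mk4 (by omega) (by omega))
      have h3 : u + 2 < v := by
        by_contra h3
        exact hQ (Q_mk8 (by omega) (by omega))
      rcases le_total (2 * (u + 2)) v with h | h
      · exact move02 (u + 2) (by omega) (by omega) (Q_mk5 (by omega) (by omega))
      · exact move02 (v - u - 2) (by omega) (by omega) (Q_mk8 (by omega) (by omega))
    · by_cases h2 : u = 1
      · by_cases h3 : v % 8 = 3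
        · exact move12 ((v - u) / 2) (by omega) (by omega) (Q_mk3 (by omega) (by omega))
        · exact move12 ((v - u) / 2 - 1) (by omega) (by omega) (Q_mk8 (by omega) (by omega))
      have h3 : 3 ≤ u := by
        by_contra h3
        exact hQ (Q_mk4 (by omega) (by omega))
      rcases le_total (2 * (u - 2)) v with h | h
      · exact move02 (u - 2) (by omega) (by omega) (Q_mk4 (by omega) (by omega))
      · exact move02 (v - (u - 2)) (by omega) (by omega) (Q_mk9 (by omega) (by omega))

theorem exists_P (x y z : ℕ) : P x y z ∨ R P x y z := by
  refine sorted_reduction (fun x y z => P x y z ∨ R P x y z) ?_ ?_ exists_P_sorted x y z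
  · rintro x y z (h | h)
    · exact Or.inl (P_12 _ _ _ h)
    · exact Or.inr (R_12 P P_12 _ _ _ h)
  · rintro x y z (h | h)
    · exact Or.inl (P_23 _ _ _ h)
    · exact Or.inr (R_23 P P_23 _ _ _ h)

theorem exists_Q (x y z : ℕ) : P x y z ∨ Q x y z ∨ R Q x y z := by
  refine sorted_reduction (fun x y z => P x y z ∨ Q x y z ∨ R Q x y z) ?_ ?_
    exists_Q_sorted x y z
  · rintro x y z (h | h | h)
    · exact Or.inl (P_12 _ _ _ h)
    · exact Or.inr (Or.inl (Q_12 _ _ _ h))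
    · exact Or.inr (Or.inr (R_12 Q Q_12 _ _ _ h))
  · rintro x y z (h | h | h)
    · exact Or.inl (P_23 _ _ _ h)
    · exact Or.inr (Or.inl (Q_23 _ _ _ h))
    · exact Or.inr (Or.inr (R_23 Q Q_23 _ _ _ h))

theorem mex_not_mem (s : Finset ℕ) : mex s ∉ s :=
  Nat.sInf_mem (s := {n : ℕ | n ∉ s}) s.exists_notMem

theorem mem_of_lt_mex (s : Finset ℕ) (n : ℕ) (h : n < mex s) : n ∈ s := by
  by_contra hn
  exact Nat.notMem_of_lt_sInf (s := {n : ℕ | n ∉ s}) h hn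

theorem G_ne_of_move {p q : ℕ × ℕ × ℕ} (h : q ∈ moves p) : G q ≠ G p := by
  intro he
  have h1 := mex_not_mem ((moves p).attach.image fun q => G q.1)
  rw [← G] at h1
  apply h1
  rw [Finset.mem_image]
  exact ⟨⟨q, h⟩, Finset.mem_attach _ _, he⟩

theorem exists_move_of_lt {p : ℕ × ℕ × ℕ} {n : ℕ} (h : n < G p) : ∃ q ∈ moves p, G q = n := by
  rw [G] at h
  have h1 := mem_of_lt_mex _ _ h
  rw [Finset.mem_image] at h1
  obtain ⟨⟨q, hq⟩, -, h2⟩ := h1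
  exact ⟨q, hq, h2⟩

theorem G_char (n : ℕ) : ∀ p : ℕ × ℕ × ℕ, measure3 p = n →
    (G p = 0 ↔ P p.1 p.2.1 p.2.2) ∧ (G p = 1 ↔ Q p.1 p.2.1 p.2.2) := by
  induction n using Nat.strong_induction_on with
  | _ n ih =>
    rintro ⟨x, y, z⟩ hp
    have ih0 : ∀ q ∈ moves (x, y, z), (G q = 0 ↔ P q.1 q.2.1 q.2.2) := fun q hq =>
      (ih _ (hp ▸ measure3_lt_of_mem_moves hq) q rfl).1
    have ih1 : ∀ q ∈ moves (x, y, z), (G q = 1 ↔ Q q.1 q.2.1 q.2.2) := fun q hq =>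
      (ih _ (hp ▸ measure3_lt_of_mem_moves hq) q rfl).2
    have key0 : G (x, y, z) = 0 ↔ P x y z := by
      constructor
      · intro h
        rcases exists_P x y z with h' | h'
        · exact h'
        · obtain ⟨q, hq, hT⟩ := (exists_move_iff P x y z).2 h'
          exact absurd (((ih0 q hq).2 hT).trans h.symm) (G_ne_of_move hq)
      · intro h
        by_contra h0
        obtain ⟨q, hq, hG⟩ := exists_move_of_lt (Nat.pos_of_ne_zero h0)
        exact no_PP x y z h ((exists_move_iff P x y z).1 ⟨q, hq, (ih0 q hq).1 hG⟩)
    refine ⟨key0, ?_⟩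
    constructor
    · intro h
      rcases exists_Q x y z with h' | h' | h'
      · have := key0.2 h'
        omega
      · exact h'
      · obtain ⟨q, hq, hT⟩ := (exists_move_iff Q x y z).2 h'
        exact absurd (((ih1 q hq).2 hT).trans h.symm) (G_ne_of_move hq)
    · intro h
      have h0 : G (x, y, z) ≠ 0 := fun h0 => not_P_of_Q x y z h (key0.1 h0)
      by_contra h1
      obtain ⟨q, hq, hG⟩ := exists_move_of_lt (p := (x, y, z)) (n := 1) (by omega)
      exact no_QQ x y z h ((exists_move_iff Q x y z).1 ⟨q, hq, (ih1 q hq).1 hG⟩)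

/-- For `a ≤ b`, `G(0,a,b) = 1` iff `(a,b)` is one of `(0, 4k+2)`,
`(4k+2, 4k+2)` for `k ≥ 0`, `(1,2)`, `(2, 4k+1)` for `k ≥ 1`, or `(4l-1, 4l+1)`
for `l ≥ 1`. -/
theorem grundy_one_iff (a b : ℕ) (hab : a ≤ b) :
    G (0, a, b) = 1 ↔
      (a = 0 ∧ ∃ k : ℕ, b = 4 * k + 2) ∨
      (∃ k : ℕ, a = 4 * k + 2 ∧ b = 4 * k + 2) ∨
      (a = 1 ∧ b = 2) ∨
      (a = 2 ∧ ∃ k : ℕ, 1 ≤ k ∧ b = 4 * k + 1) ∨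
      (∃ l : ℕ, 1 ≤ l ∧ a = 4 * l - 1 ∧ b = 4 * l + 1) := by
  rw [(G_char _ (0, a, b) rfl).2]
  change Q 0 a b ↔ _
  constructor
  · intro h
    rcases h with h | h | h | h | h | h | h | h | h
    · exact Or.inl ⟨by omega, b / 4, by omega⟩
    · omega
    · exact Or.inr (Or.inl ⟨a / 4, by omega, by omega⟩)
    · by_cases hb : b = 1
      · omega
      · exact Or.inr (Or.inr (Or.inr (Or.inl ⟨by omega, b / 4, by omega, by omega⟩)))
    · omega
    · exact Or.inr (Or.inr (Or.inl (by omega)))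
    · omega
    · exact Or.inr (Or.inr (Or.inr (Or.inr ⟨b / 4, by omega, by omega, by omega⟩)))
    · omega
  · rintro (⟨h, k, hk⟩ | ⟨k, h, hk⟩ | ⟨h, hk⟩ | ⟨h, k, h1, hk⟩ | ⟨k, h1, h, hk⟩)
    · exact Q_mk1 (by omega) (by omega)
    · exact Q_mk3 (by omega) (by omega)
    · exact Q_mk6 (by omega) (by omega)
    · exact Q_mk4 (by omega) (by omega)
    · exact Q_mk8 (by omega) (by omega)

end SharingNim
end
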